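/- arXiv:2408.06902 — 4 statements merged into one kernel-verified Lean document; each statement's English description precedes it below -/
import Mathlib

section
/- Let m ≥ 1 and let a be a positive integer. The entries of the a-th power of the matrix R_m(q) over ℤ[q] are: (R_m(q)^a)_{ij} = q^{a(m+1−j)} · binom(a+j−i−1, j−i)_q for 1 ≤ i ≤ j ≤ m+1, and (R_m(q)^a)_{ij} = 0 for i > j. Equivalently, for j = i+k with k ≥ 0, (R_m(q)^a)_{i,i+k} = q^{a(m+1−i−k)} · mbinom(a,k)_q. -/
open Polynomial Finset

namespace QHCF

noncomputable section

/-! ### Border strips and P-partitions -/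

/-- The full alternating step list: `replicate a₁ b ++ replicate a₂ (!b) ++ ⋯`. -/
def fullSteps : List ℕ → Bool → List Bool
  | [], _ => []
  | x :: xs, b => List.replicate x b ++ fullSteps xs (!b)

/-- The step sequence of the border strip `𝒢[a₁,…,aₙ]`: `(a₁−1)` up steps (`true`),
then `a₂` right steps (`false`), then `a₃` up steps, alternating, ending with
`(aₙ−1)` final steps. -/
def steps (a : List ℕ) : List Bool := ((fullSteps a true).drop 1).dropLast

/-- The number of boxes `N = a₁+⋯+aₙ−1` of the border strip `𝒢[a₁,…,aₙ]`. -/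
def boxCount (a : List ℕ) : ℕ := a.sum - 1

/-- `σ` is a P-partition on `𝒢[a₁,…,aₙ]` with parts at most `m`:
`σ(t+1) ≤ σ(t)` on up steps and `σ(t) ≤ σ(t+1)` on right steps. -/
def IsPP (m : ℕ) (a : List ℕ) (σ : Fin (boxCount a) → Fin (m + 1)) : Prop :=
  ∀ (t : ℕ) (h : t + 1 < boxCount a),
    if (steps a).getD t true
    then ((σ ⟨t + 1, h⟩ : ℕ) ≤ (σ ⟨t, Nat.lt_of_succ_lt h⟩ : ℕ))
    else ((σ ⟨t, Nat.lt_of_succ_lt h⟩ : ℕ) ≤ (σ ⟨t + 1, h⟩ : ℕ))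

/-- The set of P-partitions on `𝒢[a₁,…,aₙ]` with parts at most `m`. -/
noncomputable def PP (m : ℕ) (a : List ℕ) : Finset (Fin (boxCount a) → Fin (m + 1)) :=
  @Finset.filter _ (IsPP m a) (Classical.decPred _) Finset.univ

/-- The weight of a P-partition: the sum of its parts. -/
def wt {N m : ℕ} (σ : Fin N → Fin (m + 1)) : ℕ := ∑ t, (σ t : ℕ)

/-- The number of P-partitions (parts at most `m`) satisfying a further predicate `p`. -/
noncomputable def PPcount (m : ℕ) (a : List ℕ)
    (p : (Fin (boxCount a) → Fin (m + 1)) → Prop) : ℕ :=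
  (@Finset.filter _ p (Classical.decPred _) (PP m a)).card

/-- The weight generating function `Σ q^{wt σ}` over P-partitions satisfying `p`. -/
noncomputable def PPgen (m : ℕ) (a : List ℕ)
    (p : (Fin (boxCount a) → Fin (m + 1)) → Prop) : Polynomial ℤ :=
  ∑ σ ∈ @Finset.filter _ p (Classical.decPred _) (PP m a), (X : Polynomial ℤ) ^ wt σ

/-- `Ω_m(𝒢,q)`: the weight generating function of all P-partitions with parts at most `m`. -/
noncomputable def Omega (m : ℕ) (a : List ℕ) : Polynomial ℤ := PPgen m a fun _ => True

/-- Generating function over P-partitions with first part `≤ b` and last part `≤ c`. -/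
noncomputable def OmegaLE (m : ℕ) (a : List ℕ) (b c : ℕ) : Polynomial ℤ :=
  PPgen m a fun σ =>
    (∀ h : 0 < boxCount a, (σ ⟨0, h⟩ : ℕ) ≤ b) ∧
    (∀ h : 0 < boxCount a, (σ ⟨boxCount a - 1, Nat.sub_lt h Nat.one_pos⟩ : ℕ) ≤ c)

/-- Generating function over P-partitions with first part `≤ b` and last part `≥ c`. -/
noncomputable def OmegaGE (m : ℕ) (a : List ℕ) (b c : ℕ) : Polynomial ℤ :=
  PPgen m a fun σ =>
    (∀ h : 0 < boxCount a, (σ ⟨0, h⟩ : ℕ) ≤ b) ∧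
    (∀ h : 0 < boxCount a, c ≤ (σ ⟨boxCount a - 1, Nat.sub_lt h Nat.one_pos⟩ : ℕ))

/-! ### Matrices over ℤ -/

/-- `R_m`, the `(m+1)×(m+1)` upper-triangular matrix of ones. -/
def Rmat (m : ℕ) : Matrix (Fin (m + 1)) (Fin (m + 1)) ℤ :=
  Matrix.of fun i j => if i ≤ j then 1 else 0

/-- `W_m`, the antidiagonal permutation matrix (`(W_m)_{ij} = 1` iff `i+j = m+2`, 1-based). -/
def Wmat (m : ℕ) : Matrix (Fin (m + 1)) (Fin (m + 1)) ℤ :=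
  Matrix.of fun i j => if (i : ℕ) + 1 + ((j : ℕ) + 1) = m + 2 then 1 else 0

/-- `Λ_m(a) = R_m^a · W_m`. -/
def Lam (m a : ℕ) : Matrix (Fin (m + 1)) (Fin (m + 1)) ℤ := Rmat m ^ a * Wmat m

/-- The product `Λ_m(a₁)Λ_m(a₂)⋯Λ_m(aₙ)`. -/
def LamProd (m : ℕ) (a : List ℕ) : Matrix (Fin (m + 1)) (Fin (m + 1)) ℤ :=
  (a.map fun x => Lam m x).prod

/-! ### q-deformed matrices over ℤ[q] (with `q = Polynomial.X`) -/

/-- `R_m` as a matrix over `ℤ[q]`. -/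
def RmatQ (m : ℕ) : Matrix (Fin (m + 1)) (Fin (m + 1)) (Polynomial ℤ) :=
  Matrix.of fun i j => if i ≤ j then 1 else 0

/-- `L_m = R_m^⊤` as a matrix over `ℤ[q]`. -/
def LmatQ (m : ℕ) : Matrix (Fin (m + 1)) (Fin (m + 1)) (Polynomial ℤ) := (RmatQ m).transpose

/-- `Q_m = diag(q^m, q^{m-1}, …, q, 1)`. -/
def Qmat (m : ℕ) : Matrix (Fin (m + 1)) (Fin (m + 1)) (Polynomial ℤ) :=
  Matrix.diagonal fun i => X ^ (m - (i : ℕ))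

/-- `R_m(q) := R_m · Q_m`. -/
def Rq (m : ℕ) : Matrix (Fin (m + 1)) (Fin (m + 1)) (Polynomial ℤ) := RmatQ m * Qmat m

/-- `L_m(q) := L_m · Q_m`. -/
def Lq (m : ℕ) : Matrix (Fin (m + 1)) (Fin (m + 1)) (Polynomial ℤ) := LmatQ m * Qmat m

/-- `W_m` as a matrix over `ℤ[q]`. -/
def WmatQ (m : ℕ) : Matrix (Fin (m + 1)) (Fin (m + 1)) (Polynomial ℤ) :=
  Matrix.of fun i j => if (i : ℕ) + 1 + ((j : ℕ) + 1) = m + 2 then 1 else 0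

/-- `Λ⁺_m(q,a) := R_m(q)^a · W_m`. -/
def LamP (m a : ℕ) : Matrix (Fin (m + 1)) (Fin (m + 1)) (Polynomial ℤ) := Rq m ^ a * WmatQ m

/-- `Λ⁻_m(q,a) := W_m · L_m(q)^a`. -/
def LamM (m a : ℕ) : Matrix (Fin (m + 1)) (Fin (m + 1)) (Polynomial ℤ) := WmatQ m * Lq m ^ a

/-- Alternating product of `Λ⁺`/`Λ⁻` matrices (`b = true` starts with `Λ⁺`). -/
def altLam (m : ℕ) : List ℕ → Bool → Matrix (Fin (m + 1)) (Fin (m + 1)) (Polynomial ℤ)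
  | [], _ => 1
  | x :: xs, b => (if b then LamP m x else LamM m x) * altLam m xs (!b)

/-- `X_𝒢(q) = Λ⁺_m(q,a₁)Λ⁻_m(q,a₂)Λ⁺_m(q,a₃)⋯`. -/
def XG (m : ℕ) (a : List ℕ) : Matrix (Fin (m + 1)) (Fin (m + 1)) (Polynomial ℤ) :=
  altLam m a true

/-- Alternating product of powers of `R_m(q)` and `L_m(q)` (`b = true` starts with `R`). -/
def altRL (m : ℕ) : List ℕ → Bool → Matrix (Fin (m + 1)) (Fin (m + 1)) (Polynomial ℤ)
  | [], _ => 1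
  | x :: xs, b => (if b then Rq m ^ x else Lq m ^ x) * altRL m xs (!b)

/-- `R_m(q)^{a₁} L_m(q)^{a₂} R_m(q)^{a₃} ⋯`. -/
def RLProd (m : ℕ) (a : List ℕ) : Matrix (Fin (m + 1)) (Fin (m + 1)) (Polynomial ℤ) :=
  altRL m a true

/-! ### Gaussian binomial coefficients -/

/-- The Gaussian binomial coefficient `binom(n,k)_q ∈ ℤ[q]`, defined via the
q-Pascal recursion `binom(n,k)_q = binom(n−1,k−1)_q + q^k·binom(n−1,k)_q`;
it equals `[n]_q!/([k]_q![n−k]_q!)`. -/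
def qbinom : ℕ → ℕ → Polynomial ℤ
  | _, 0 => 1
  | 0, _ + 1 => 0
  | n + 1, k + 1 => qbinom n k + X ^ (k + 1) * qbinom n (k + 1)

/-- The q-multichoose coefficient `mbinom(n,k)_q := binom(n+k−1,k)_q`. -/
def qmbinom (n k : ℕ) : Polynomial ℤ := qbinom (n + k - 1) k

/-! ### Higher q-continued fractions -/

/-- The higher q-continued fraction
`r^q_{i,m}(a₁,…,aₙ) := Ω_m^{m+1−i,1}(𝒢,q) · (Ω_m^{m+1,1}(𝒢,q))⁻¹ ∈ ℤ⟦q⟧`,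
i.e. the generating function over P-partitions with first part `≤ i`, divided by the
one over P-partitions with first part `= 0` (whose constant term is `1`). -/
noncomputable def rq (m i : ℕ) (a : List ℕ) : PowerSeries ℤ :=
  (↑(OmegaLE m a i m) : PowerSeries ℤ) *
    PowerSeries.invOfUnit (↑(OmegaLE m a 0 m) : PowerSeries ℤ) 1

/-- The value `v(a₁,…,aₙ)` of a finite continued fraction `a₁ + 1/(a₂ + 1/(⋯))`. -/
def cfVal : List ℕ → ℚ
  | [] => 1
  | [x] => (x : ℚ)
  | x :: y :: xs => (x : ℚ) + 1 / cfVal (y :: xs)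

end

end QHCF

open QHCF

theorem qbinom_self_succ (n : ℕ) : qbinom n (n + 1) = 0 := by
  suffices h : ∀ n k, n < k → qbinom n k = 0 from h n _ n.lt_succ_self
  intro n
  induction n with
  | zero => rintro (_ | k) h <;> simp_all [qbinom]
  | succ n ih =>
    rintro (_ | k) h
    · omega
    · simp [qbinom, ih k (by omega), ih (k + 1) (by omega)]

theorem qmbinom_zero_right (a : ℕ) : qmbinom a 0 = 1 := by
  simp [qmbinom, qbinom]

theorem qmbinom_zero_succ (k : ℕ) : qmbinom 0 (k + 1) = 0 := by
  simp [qmbinom, qbinom_self_succ]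

theorem qmbinom_succ_succ (a k : ℕ) :
    qmbinom (a + 1) (k + 1) = qmbinom (a + 1) k + X ^ (k + 1) * qmbinom a (k + 1) := by
  have h₁ : a + 1 + (k + 1) - 1 = a + k + 1 := by omega
  have h₂ : a + 1 + k - 1 = a + k := by omega
  have h₃ : a + (k + 1) - 1 = a + k := by omega
  simp [qmbinom, h₁, h₂, h₃, qbinom]

theorem sum_X_pow_mul_qmbinom (a k : ℕ) :
    ∑ s ∈ range (k + 1), X ^ s * qmbinom a s = qmbinom (a + 1) k := by
  induction k with
  | zero => simp [qmbinom_zero_right]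
  | succ k ih => rw [sum_range_succ, ih, qmbinom_succ_succ]

theorem Rq_apply (m : ℕ) (i j : Fin (m + 1)) :
    Rq m i j = if i ≤ j then X ^ (m - (j : ℕ)) else 0 := by
  simp [Rq, RmatQ, Qmat, Matrix.mul_diagonal]

/-- Entries of `R_m(q)^a`, with 0-based indices. -/
theorem Rq_pow_apply (m a : ℕ) (i j : Fin (m + 1)) :
    (Rq m ^ a) i j =
      if i ≤ j then X ^ (a * (m - (j : ℕ))) * qmbinom a ((j : ℕ) - i) else 0 := by
  induction a generalizing i with
  | zero =>
    rcases lt_trichotomy i j with h | rfl | h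
    · obtain ⟨k, hk⟩ := Nat.exists_eq_add_of_lt (Fin.lt_def.mp h)
      have hk' : (j : ℕ) - i = k + 1 := by omega
      simp [h.ne, hk', qmbinom_zero_succ]
    · simp [qmbinom_zero_right]
    · simp [h.ne', h.not_ge]
  | succ a ih =>
    simp only [pow_succ', Matrix.mul_apply, ih, Rq_apply]
    split_ifs with hij
    · rw [← sum_X_pow_mul_qmbinom, mul_sum]
      simp only [ite_mul, mul_ite, zero_mul, mul_zero, ← ite_and, ← sum_filter]
      have hij' : (i : ℕ) ≤ j := hij
      refine sum_bij' (fun l _ => (j : ℕ) - l)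
        (fun s _ => ⟨(j : ℕ) - s, by omega⟩) ?_ ?_ ?_ ?_ ?_
      · intro l hl
        simp only [mem_filter, mem_univ, true_and, Fin.le_def, mem_range] at hl ⊢
        omega
      · intro s hs
        simp only [mem_filter, mem_univ, true_and, Fin.le_def, mem_range] at hs ⊢
        omega
      · intro l hl
        simp only [mem_filter, mem_univ, true_and, Fin.le_def] at hl
        ext
        simp only
        omega
      · intro s hs
        simp only [mem_range] at hs ⊢
        omega
      · intro l hl
        simp only [mem_filter, mem_univ, true_and, Fin.le_def] at hl
        have h : m - (l : ℕ) = (m - (j : ℕ)) + ((j : ℕ) - l) := by omega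
        rw [h]
        ring
    · refine sum_eq_zero fun l _ => ?_
      split_ifs with h₁ h₂
      · exact absurd (h₁.trans h₂) hij
      all_goals simp

/-- Entries of `R_m(q)^a` (1-based indices):
`(R_m(q)^a)_{ij} = q^{a(m+1−j)}·binom(a+j−i−1, j−i)_q` for `i ≤ j`, and `0` for `i > j`;
equivalently, for `j = i+k`, `(R_m(q)^a)_{i,i+k} = q^{a(m+1−i−k)}·mbinom(a,k)_q`. -/
theorem statement4 (m a : ℕ) (hm : 1 ≤ m) (ha : 1 ≤ a)
    (i j : ℕ) (hi1 : 1 ≤ i) (hi2 : i ≤ m + 1) (hj1 : 1 ≤ j) (hj2 : j ≤ m + 1) :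
    (i ≤ j →
      (Rq m ^ a) ⟨i - 1, by omega⟩ ⟨j - 1, by omega⟩ =
        X ^ (a * (m + 1 - j)) * qbinom (a + j - i - 1) (j - i)) ∧
    (j < i → (Rq m ^ a) ⟨i - 1, by omega⟩ ⟨j - 1, by omega⟩ = 0) ∧
    (∀ k : ℕ, j = i + k →
      (Rq m ^ a) ⟨i - 1, by omega⟩ ⟨j - 1, by omega⟩ =
        X ^ (a * (m + 1 - i - k)) * qmbinom a k) := by
  have h := Rq_pow_apply m a ⟨i - 1, by omega⟩ ⟨j - 1, by omega⟩
  simp only [Fin.mk_le_mk] at h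
  refine ⟨fun hij => ?_, fun hij => ?_, ?_⟩
  · rw [h, if_pos (by omega), qmbinom]
    congr 2 <;> grind
  · rw [h, if_neg (by omega)]
  · rintro k rfl
    rw [h, if_pos (by omega)]
    congr 2 <;> grind
end

section
/- Let m ≥ 1 and let a be a positive integer. The entries of the a-th power of the matrix L_m(q) over ℤ[q] are: (L_m(q)^a)_{ij} = q^{a(m+1−i)} · q^{i−j} · binom(a+i−j−1, i−j)_q for 1 ≤ j ≤ i ≤ m+1, and (L_m(q)^a)_{ij} = 0 for i < j. Equivalently, (L_m(q)^a)_{ij} = q^{i−j} · (R_m(q)^a)_{ji} for all i, j, and L_m(q)^a = Q_m^{−1} (R_m(q)^a)^⊤ Q_m as matrices over ℤ[q,q^{−1}]. -/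
open Polynomial Finset

open QHCF

/-- `Q_m = diag(q^m,…,q,1)` as a matrix over the Laurent polynomials `ℤ[q,q⁻¹]`. -/
noncomputable def QmatL (m : ℕ) : Matrix (Fin (m + 1)) (Fin (m + 1)) (LaurentPolynomial ℤ) :=
  Matrix.diagonal fun i => LaurentPolynomial.T ((m : ℤ) - ((i : ℕ) : ℤ))

theorem qbinom_eq_zero_of_lt : ∀ {n k : ℕ}, n < k → qbinom n k = 0
  | 0, _ + 1, _ => by rw [qbinom]
  | n + 1, k + 1, h => by
    rw [qbinom, qbinom_eq_zero_of_lt (show n < k by omega),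
      qbinom_eq_zero_of_lt (show n < k + 1 by omega)]
    simp

theorem qbinom_zero_right (n : ℕ) : qbinom n 0 = 1 := by
  cases n <;> rw [qbinom]

theorem qbinom_self : ∀ n : ℕ, qbinom n n = 1
  | 0 => by rw [qbinom]
  | n + 1 => by
    rw [qbinom, qbinom_self n, qbinom_eq_zero_of_lt (Nat.lt_succ_self n)]
    simp

/-- The `q`-hockey-stick identity. -/
theorem sum_X_pow_mul_qbinom (b d : ℕ) :
    ∑ l ∈ range (d + 1), X ^ l * qbinom (b + l) l = qbinom (b + 1 + d) d := by
  induction d with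
  | zero => simp [qbinom_zero_right]
  | succ d ih =>
    rw [sum_range_succ, ih, show b + 1 + (d + 1) = (b + (d + 1)) + 1 by omega, qbinom,
      show b + (d + 1) = b + 1 + d by omega]

theorem Lq_apply (m : ℕ) (i j : Fin (m + 1)) :
    Lq m i j = if (j : ℕ) ≤ i then X ^ (m - (j : ℕ)) else 0 := by
  simp [Lq, LmatQ, RmatQ, Qmat, Matrix.mul_diagonal]

theorem Lq_pow_succ_apply (m b : ℕ) (i j : Fin (m + 1)) :
    (Lq m ^ (b + 1)) i j =
      if (j : ℕ) ≤ i then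
        X ^ ((b + 1) * (m - (i : ℕ))) * (X ^ ((i : ℕ) - j) * qbinom (b + ((i : ℕ) - j)) (i - j))
      else 0 := by
  induction b generalizing j with
  | zero =>
    rw [zero_add, pow_one, Lq_apply]
    split_ifs with h
    · rw [zero_add, qbinom_self, mul_one, ← pow_add]
      congr 1
      omega
    · rfl
  | succ b ih =>
    obtain ⟨i, hi⟩ := i
    obtain ⟨j, hj⟩ := j
    rw [pow_succ, Matrix.mul_apply]
    simp only [ih, Lq_apply]
    rw [Fin.sum_univ_eq_sum_range (fun k => (if k ≤ i then
        X ^ ((b + 1) * (m - i)) * (X ^ (i - k) * qbinom (b + (i - k)) (i - k)) else 0) *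
        (if j ≤ k then X ^ (m - j) else 0))]
    split_ifs with h
    · rw [← sum_X_pow_mul_qbinom, ← mul_assoc, ← pow_add, mul_sum]
      have hsub : Icc j i ⊆ range (m + 1) := fun k hk => by
        simp only [mem_Icc, mem_range] at hk ⊢
        omega
      rw [← sum_subset hsub]
      · refine sum_nbij' (fun k => i - k) (fun l => i - l) ?_ ?_ ?_ ?_ ?_ <;>
          simp only [mem_Icc, mem_range]
        · intro k hk; omega
        · intro l hl; omega
        · intro k hk; omega
        · intro l hl; omega
        · intro k hk
          rw [if_pos hk.2, if_pos hk.1, mul_right_comm, ← pow_add]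
          congr 2
          rw [add_mul (b + 1), one_mul]
          omega
      · intro k _ hk
        rw [mem_Icc, not_and_or] at hk
        rcases hk with hk | hk <;> simp [hk]
    · refine sum_eq_zero fun k _ => ?_
      by_cases hk : k ≤ i
      · rw [if_neg (show ¬ j ≤ k by omega), mul_zero]
      · rw [if_neg hk, zero_mul]

theorem isUnit_det_QmatL (m : ℕ) : IsUnit (QmatL m).det := by
  rw [QmatL, Matrix.det_diagonal]
  exact IsUnit.prod_univ_iff.2 fun i => LaurentPolynomial.isUnit_T _

theorem map_Qmat (m : ℕ) : (Qmat m).map Polynomial.toLaurent = QmatL m := by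
  rw [Qmat, QmatL, Matrix.diagonal_map (map_zero _)]
  congr 1
  funext i
  rw [Polynomial.toLaurent_X_pow]
  congr 1
  omega

theorem QmatL_mul_map_Lq_pow (m a : ℕ) :
    QmatL m * (Lq m ^ a).map Polynomial.toLaurent =
      ((Rq m ^ a).map Polynomial.toLaurent).transpose * QmatL m := by
  have hQ : (Qmat m).transpose = Qmat m := Matrix.diagonal_transpose _
  have key : SemiconjBy (Qmat m) (Lq m) (Rq m).transpose := by
    rw [SemiconjBy, Rq, Matrix.transpose_mul, hQ, Lq, LmatQ, mul_assoc]
  have h := congrArg (fun M => M.map Polynomial.toLaurent) (key.pow_right a).eq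
  simpa only [Matrix.map_mul, map_Qmat, ← Matrix.transpose_pow, Matrix.transpose_map] using h

/-- Entries of `L_m(q)^a` (1-based indices):
`(L_m(q)^a)_{ij} = q^{a(m+1−i)}·q^{i−j}·binom(a+i−j−1, i−j)_q` for `j ≤ i`, and `0` for
`i < j`; equivalently `(L_m(q)^a)_{ij} = q^{i−j}·(R_m(q)^a)_{ji}` and
`L_m(q)^a = Q_m⁻¹ (R_m(q)^a)^⊤ Q_m` over `ℤ[q,q⁻¹]`. -/
theorem statement5 (m a : ℕ) (hm : 1 ≤ m) (ha : 1 ≤ a)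
    (i j : ℕ) (hi1 : 1 ≤ i) (hi2 : i ≤ m + 1) (hj1 : 1 ≤ j) (hj2 : j ≤ m + 1) :
    (j ≤ i →
      (Lq m ^ a) ⟨i - 1, by omega⟩ ⟨j - 1, by omega⟩ =
        X ^ (a * (m + 1 - i)) * (X ^ (i - j) * qbinom (a + i - j - 1) (i - j))) ∧
    (i < j → (Lq m ^ a) ⟨i - 1, by omega⟩ ⟨j - 1, by omega⟩ = 0) ∧
    ((Lq m ^ a).map Polynomial.toLaurent ⟨i - 1, by omega⟩ ⟨j - 1, by omega⟩ =
      LaurentPolynomial.T ((i : ℤ) - (j : ℤ)) *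
        (Rq m ^ a).map Polynomial.toLaurent ⟨j - 1, by omega⟩ ⟨i - 1, by omega⟩) ∧
    ((Lq m ^ a).map Polynomial.toLaurent =
      (QmatL m)⁻¹ * ((Rq m ^ a).map Polynomial.toLaurent).transpose * QmatL m) := by
  have hconj := QmatL_mul_map_Lq_pow m a
  obtain ⟨b, rfl⟩ : ∃ b, a = b + 1 := ⟨a - 1, by omega⟩
  refine ⟨fun h => ?_, fun h => ?_, ?_, ?_⟩
  · rw [Lq_pow_succ_apply, if_pos (show j - 1 ≤ i - 1 by omega)]
    dsimp only
    rw [show m - (i - 1) = m + 1 - i by omega, show i - 1 - (j - 1) = i - j by omega,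
      show b + 1 + i - j - 1 = b + (i - j) by omega]
  · rw [Lq_pow_succ_apply, if_neg (show ¬ j - 1 ≤ i - 1 by omega)]
  · have h := congrFun (congrFun hconj ⟨i - 1, by omega⟩) ⟨j - 1, by omega⟩
    rw [QmatL, Matrix.diagonal_mul, Matrix.mul_diagonal, Matrix.transpose_apply] at h
    have h' := congrArg (LaurentPolynomial.T (-((m : ℤ) - ((i - 1 : ℕ) : ℤ))) * ·) h
    dsimp only at h'
    rw [← mul_assoc, ← LaurentPolynomial.T_add, neg_add_cancel, LaurentPolynomial.T_zero,
      one_mul] at h'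
    rw [h', mul_left_comm, ← LaurentPolynomial.T_add, mul_comm]
    congr 2
    omega
  · rw [mul_assoc, ← hconj, Matrix.nonsing_inv_mul_cancel_left _ _ (isUnit_det_QmatL m)]
end

section
/- Let m ≥ 1 and let (a_1,…,a_{2n}) be a sequence of positive integers with border strip 𝒢 = 𝒢[a_1,…,a_{2n}]. Then the (1,1)-entry of the matrix product R_m(q)^{a_1} L_m(q)^{a_2} R_m(q)^{a_3} L_m(q)^{a_4} ⋯ R_m(q)^{a_{2n−1}} L_m(q)^{a_{2n}} over ℤ[q] equals q^m · Ω_m(𝒢,q), where Ω_m(𝒢,q) is the weight generating function of all P-partitions on 𝒢 with parts at most m. -/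
open Polynomial Finset

open QHCF

namespace QHCF

/-- The matrix of a single step: `R_m(q)` for an up step, `L_m(q)` for a right step. -/
noncomputable def stepMat (m : ℕ) (b : Bool) :
    Matrix (Fin (m + 1)) (Fin (m + 1)) (Polynomial ℤ) :=
  if b then Rq m else Lq m

/-- The inequality imposed between consecutive parts by a single step. -/
def StepRel {m : ℕ} (b : Bool) (v w : Fin (m + 1)) : Prop :=
  if b then w ≤ v else v ≤ w

/-- `σ` satisfies the inequalities imposed by the step list `l`. -/
def IsChain {m N : ℕ} (l : List Bool) (σ : Fin (N + 1) → Fin (m + 1)) : Prop :=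
  ∀ t : Fin N, StepRel (l.getD t true) (σ t.castSucc) (σ t.succ)

theorem isChain_cons {m N : ℕ} (b : Bool) (l : List Bool) (v : Fin (m + 1))
    (σ : Fin (N + 1) → Fin (m + 1)) :
    IsChain (b :: l) (Fin.cons v σ : Fin (N + 2) → Fin (m + 1)) ↔
      StepRel b v (σ 0) ∧ IsChain l σ := by
  unfold IsChain
  rw [Fin.forall_fin_succ]
  simp

theorem wt_cons {m N : ℕ} (v : Fin (m + 1)) (σ : Fin N → Fin (m + 1)) :
    wt (Fin.cons v σ : Fin (N + 1) → Fin (m + 1)) = v + wt σ := by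
  simp [wt, Fin.sum_univ_succ]

theorem sum_fin_cons {α M : Type*} [Fintype α] [AddCommMonoid M] {N : ℕ}
    (f : (Fin (N + 1) → α) → M) :
    ∑ σ, f σ = ∑ w, ∑ σ : Fin N → α, f (Fin.cons w σ) := by
  rw [← (Fin.consEquiv fun _ : Fin (N + 1) => α).sum_comp, Fintype.sum_prod_type]
  rfl

open Classical in
theorem stepMat_rev (m : ℕ) (b : Bool) (v w : Fin (m + 1)) :
    stepMat m b v.rev w.rev = if StepRel b v w then X ^ (w : ℕ) else 0 := by
  have hw : m + 1 - ((w : ℕ) + 1) = m - w := by omega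
  have hw' : m - (m - (w : ℕ)) = w := by omega
  cases b <;>
    simp [stepMat, StepRel, Rq, Lq, RmatQ, LmatQ, Qmat, Matrix.mul_diagonal, Fin.val_rev, hw, hw']

open Classical in
/-- Row sums of a product of step matrices enumerate chains with prescribed first part. -/
theorem sum_prod_stepMat (m : ℕ) (l : List Bool) (N : ℕ) (hN : l.length = N) (v : Fin (m + 1)) :
    ∑ j, (l.map (stepMat m)).prod v.rev j =
      ∑ σ : Fin N → Fin (m + 1),
        if IsChain l (Fin.cons v σ : Fin (N + 1) → Fin (m + 1)) then X ^ wt σ else 0 := by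
  induction l generalizing N v with
  | nil =>
    obtain rfl : N = 0 := hN.symm
    simp [Matrix.one_apply, IsChain, wt]
  | cons b l ih =>
    obtain ⟨N, rfl⟩ : ∃ K, N = K + 1 := ⟨l.length, hN.symm⟩
    have hl : l.length = N := by simpa using hN
    rw [sum_fin_cons]
    simp only [List.map_cons, List.prod_cons, Matrix.mul_apply]
    rw [Finset.sum_comm, ← Equiv.sum_comp Fin.revPerm]
    refine Finset.sum_congr rfl fun w _ => ?_
    rw [← Finset.mul_sum, Fin.revPerm_apply, ih N hl w, stepMat_rev, Finset.mul_sum]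
    refine Finset.sum_congr rfl fun σ _ => ?_
    simp only [isChain_cons, Fin.cons_zero, wt_cons]
    by_cases h₁ : StepRel b v w <;>
      by_cases h₂ : IsChain l (Fin.cons w σ : Fin (N + 1) → Fin (m + 1)) <;>
      simp [h₁, h₂, pow_add]

open Classical in
theorem Omega_eq_sum_isChain (m : ℕ) (a : List ℕ) (N : ℕ) (hN : boxCount a = N + 1) :
    Omega m a =
      ∑ σ : Fin (N + 1) → Fin (m + 1), if IsChain (steps a) σ then X ^ wt σ else 0 := by
  have key : ∀ (K : ℕ), K = N + 1 →
      (∑ σ : Fin K → Fin (m + 1), if ∀ (t : ℕ) (h : t + 1 < K),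
        if (steps a).getD t true
        then (σ ⟨t + 1, h⟩ : ℕ) ≤ (σ ⟨t, Nat.lt_of_succ_lt h⟩ : ℕ)
        else (σ ⟨t, Nat.lt_of_succ_lt h⟩ : ℕ) ≤ (σ ⟨t + 1, h⟩ : ℕ)
        then (X : Polynomial ℤ) ^ wt σ else 0) =
      ∑ σ : Fin (N + 1) → Fin (m + 1), if IsChain (steps a) σ then X ^ wt σ else 0 := by
    rintro K rfl
    refine Finset.sum_congr rfl fun σ _ => ?_
    refine if_congr ⟨fun h t => ?_, fun h t ht => ?_⟩ rfl rfl
    · exact h t (by omega)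
    · exact h ⟨t, by omega⟩
  rw [← key _ hN, Omega, PPgen, PP]
  simp only [Finset.filter_true, Finset.sum_filter, IsPP]
  exact Finset.sum_congr rfl fun σ _ => if_congr Iff.rfl rfl rfl

theorem altRL_eq_prod (m : ℕ) (a : List ℕ) (b : Bool) :
    altRL m a b = ((fullSteps a b).map (stepMat m)).prod := by
  induction a generalizing b with
  | nil => simp [altRL, fullSteps]
  | cons x xs ih => cases b <;> simp [altRL, fullSteps, ih, stepMat]

theorem length_fullSteps (a : List ℕ) (b : Bool) : (fullSteps a b).length = a.sum := by
  induction a generalizing b with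
  | nil => simp [fullSteps]
  | cons x xs ih => simp [fullSteps, ih]

theorem exists_fullSteps_eq_append (a : List ℕ) (ha : a ≠ []) (hpos : ∀ x ∈ a, 0 < x) (b : Bool) :
    ∃ l, fullSteps a b = l ++ [if Even a.length then !b else b] := by
  induction a generalizing b with
  | nil => exact absurd rfl ha
  | cons x xs ih =>
    rcases eq_or_ne xs [] with rfl | hxs
    · obtain ⟨k, rfl⟩ : ∃ k, x = k + 1 := ⟨x - 1, by have := hpos x (by simp); omega⟩
      exact ⟨List.replicate k b, by simp [fullSteps, List.replicate_succ']⟩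
    · obtain ⟨l, hl⟩ := ih hxs (fun y hy => hpos y (by simp [hy])) (!b)
      refine ⟨List.replicate x b ++ l, ?_⟩
      rw [fullSteps, hl]
      by_cases h : Even xs.length <;> simp [h, Nat.even_add_one]

theorem fullSteps_eq_cons_steps (a : List ℕ) (ha : a ≠ []) (heven : Even a.length)
    (hpos : ∀ x ∈ a, 0 < x) : fullSteps a true = true :: (steps a ++ [false]) := by
  obtain ⟨l, hl⟩ := exists_fullSteps_eq_append a ha hpos true
  obtain ⟨r, hr⟩ : ∃ r, fullSteps a true = true :: r := by
    obtain ⟨x, xs, rfl⟩ := List.exists_cons_of_ne_nil ha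
    obtain ⟨k, rfl⟩ : ∃ k, x = k + 1 := ⟨x - 1, by have := hpos x (by simp); omega⟩
    exact ⟨_, by rw [fullSteps, List.replicate_succ, List.cons_append]⟩
  simp only [heven, if_true, Bool.not_true] at hl
  cases l with
  | nil => simp [hl] at hr
  | cons c l =>
    have hc : c = true := by rw [hl] at hr; simpa using (List.cons.inj hr).1
    simp [steps, hl, hc]

end QHCF

/-- Theorem A.  For an even-length sequence `(a₁,…,a_{2n})` of
positive integers with border strip `𝒢`, the `(1,1)`-entry of
`R_m(q)^{a₁}L_m(q)^{a₂}⋯R_m(q)^{a_{2n−1}}L_m(q)^{a_{2n}}` equals `q^m·Ω_m(𝒢,q)`. -/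
theorem statement10 (m : ℕ) (hm : 1 ≤ m) (a : List ℕ) (ha : a ≠ [])
    (heven : Even a.length) (hpos : ∀ x ∈ a, 0 < x) :
    RLProd m a 0 0 = X ^ m * Omega m a := by
  classical
  have hfull := fullSteps_eq_cons_steps a ha heven hpos
  have hbox : boxCount a = (steps a).length + 1 := by
    have := length_fullSteps a true
    rw [hfull] at this
    simp at this
    simp only [boxCount]
    omega
  have hlast : ∀ j, stepMat m false j 0 = X ^ m := fun j => by
    simp [stepMat, Lq, LmatQ, RmatQ, Qmat, Matrix.mul_diagonal]
  have hrow := sum_prod_stepMat m (true :: steps a) _ rfl (Fin.last m)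
  rw [Fin.rev_last] at hrow
  rw [RLProd, altRL_eq_prod, hfull, ← List.cons_append, List.map_append, List.prod_append,
    Omega_eq_sum_isChain m a _ hbox, Matrix.mul_apply]
  simp only [List.map_cons, List.map_nil, List.prod_singleton, hlast] at hrow ⊢
  rw [← Finset.sum_mul, mul_comm, hrow]
  congr 1
  exact Finset.sum_congr rfl fun σ _ =>
    if_congr (by simp [isChain_cons, StepRel, Fin.le_last]) rfl rfl
end

section
/- Let m ≥ 1, let n ≥ 2 be even, and let (a_1,…,a_n) be positive integers. Let X = R_m(q)^{a_1} L_m(q)^{a_2} ⋯ R_m(q)^{a_{n−1}} L_m(q)^{a_n} over ℤ[q]. Then every 2×2 minor X_{ij}X_{i'j'} − X_{ij'}X_{i'j} (with i < i', j < j') is divisible by q^{a_1+⋯+a_n} in ℤ[q]; moreover, every 2×2 minor taken in the first and last columns (j = 1, j' = m+1) is divisible by q^{a_1+⋯+a_n+m−1}. -/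
open Polynomial Finset

open QHCF

namespace QHCF

section Minors

variable {ι κ R : Type*} [CommRing R]

/-- The `2×2` minor of `A` in rows `i, i'` and columns `j, j'`. -/
def minor₂ (A : Matrix ι κ R) (i i' : ι) (j j' : κ) : R :=
  A i j * A i' j' - A i j' * A i' j

theorem minor₂_self_col (A : Matrix ι κ R) (i i' : ι) (j : κ) : minor₂ A i i' j j = 0 :=
  sub_self _

theorem minor₂_mul [Fintype κ] {κ' : Type*} (A : Matrix ι κ R) (T : Matrix κ κ' R)
    (i i' : ι) (j j' : κ') :
    minor₂ (A * T) i i' j j' = ∑ k, ∑ l, T k j * T l j' * minor₂ A i i' k l := by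
  have h : (A * T) i j' * (A * T) i' j = (A * T) i' j * (A * T) i j' := mul_comm _ _
  simp only [minor₂, h]
  simp only [Matrix.mul_apply, Finset.sum_mul_sum, ← Finset.sum_sub_distrib]
  exact Finset.sum_congr rfl fun k _ => Finset.sum_congr rfl fun l _ => by ring

theorem dvd_minor₂_mul [Fintype κ] {κ' : Type*} {d : R} {A : Matrix ι κ R} (T : Matrix κ κ' R)
    {i i' : ι} (hA : ∀ k l, d ∣ minor₂ A i i' k l) (j j' : κ') :
    d ∣ minor₂ (A * T) i i' j j' := by
  rw [minor₂_mul]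
  exact Finset.dvd_sum fun k _ => Finset.dvd_sum fun l _ => (hA k l).mul_left _

theorem minor₂_mul_diagonal [Fintype κ] [DecidableEq κ] (A : Matrix ι κ R) (v : κ → R)
    (i i' : ι) (j j' : κ) :
    minor₂ (A * Matrix.diagonal v) i i' j j' = minor₂ A i i' j j' * (v j * v j') := by
  simp only [minor₂, Matrix.mul_diagonal]
  ring

end Minors

/-- All `2×2` minors of `A` are divisible by `q^k` and, when `k` is positive, those in the first
and last columns are divisible by `q^(k+m-1)`. -/
def MinorsDvd (m k : ℕ) (A : Matrix (Fin (m + 1)) (Fin (m + 1)) (Polynomial ℤ)) : Prop :=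
  (∀ i i' j j', (X : Polynomial ℤ) ^ k ∣ minor₂ A i i' j j') ∧
    (0 < k → ∀ i i', (X : Polynomial ℤ) ^ (k + m - 1) ∣ minor₂ A i i' 0 (Fin.last m))

theorem minorsDvd_zero (m : ℕ) (A : Matrix (Fin (m + 1)) (Fin (m + 1)) (Polynomial ℤ)) :
    MinorsDvd m 0 A :=
  ⟨fun _ _ _ _ => by simp, fun h => absurd h (lt_irrefl 0)⟩

theorem MinorsDvd.mul_Qmat {m k : ℕ} {A : Matrix (Fin (m + 1)) (Fin (m + 1)) (Polynomial ℤ)}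
    (hA : MinorsDvd m k A) (T : Matrix (Fin (m + 1)) (Fin (m + 1)) (Polynomial ℤ)) :
    MinorsDvd m (k + 1) (A * (T * Qmat m)) := by
  have hT (i i' j j' : Fin (m + 1)) : (X : Polynomial ℤ) ^ k ∣ minor₂ (A * T) i i' j j' :=
    dvd_minor₂_mul T (hA.1 i i') j j'
  rw [← Matrix.mul_assoc, Qmat]
  refine ⟨fun i i' j j' => ?_, fun _ i i' => ?_⟩
  · obtain rfl | hj := eq_or_ne j j'
    · simp [minor₂_self_col]
    · rw [minor₂_mul_diagonal, pow_succ, ← pow_add]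
      refine mul_dvd_mul (hT i i' j j') (dvd_pow_self X ?_)
      have := Fin.val_ne_of_ne hj
      omega
  · rw [minor₂_mul_diagonal, show k + 1 + m - 1 = k + m by omega, pow_add]
    exact mul_dvd_mul (hT i i' _ _) (by simp)

theorem MinorsDvd.mul_pow {m k : ℕ} {A B : Matrix (Fin (m + 1)) (Fin (m + 1)) (Polynomial ℤ)}
    (hB : ∀ {k A}, MinorsDvd m k A → MinorsDvd m (k + 1) (A * B))
    (hA : MinorsDvd m k A) (x : ℕ) : MinorsDvd m (k + x) (A * B ^ x) := by
  induction x with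
  | zero => simpa using hA
  | succ x ih =>
    rw [pow_succ, ← Matrix.mul_assoc, ← add_assoc]
    exact hB ih

theorem MinorsDvd.mul_altRL {m : ℕ} (a : List ℕ) :
    ∀ {k : ℕ} {A : Matrix (Fin (m + 1)) (Fin (m + 1)) (Polynomial ℤ)} (b : Bool),
      MinorsDvd m k A → MinorsDvd m (k + a.sum) (A * altRL m a b) := by
  induction a with
  | nil => intro k A b hA; simpa [altRL] using hA
  | cons x xs ih =>
    intro k A b hA
    rw [altRL, ← Matrix.mul_assoc, List.sum_cons, ← add_assoc]
    refine ih _ ?_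
    cases b
    · exact hA.mul_pow (B := Lq m) (fun h => h.mul_Qmat _) x
    · exact hA.mul_pow (B := Rq m) (fun h => h.mul_Qmat _) x

theorem minorsDvd_RLProd (m : ℕ) (a : List ℕ) : MinorsDvd m a.sum (RLProd m a) := by
  simpa [RLProd] using (minorsDvd_zero m 1).mul_altRL a true

end QHCF

/-- For `n` even, every `2×2` minor of
`X = R_m(q)^{a₁}L_m(q)^{a₂}⋯R_m(q)^{a_{n−1}}L_m(q)^{a_n}` is divisible by
`q^{a₁+⋯+aₙ}`, and every `2×2` minor taken in the first and last columns is divisible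
by `q^{a₁+⋯+aₙ+m−1}`. -/
theorem statement13 (m : ℕ) (hm : 1 ≤ m) (a : List ℕ) (ha : a ≠ [])
    (heven : Even a.length) (hpos : ∀ x ∈ a, 0 < x) :
    (∀ i i' j j' : Fin (m + 1), i < i' → j < j' →
      (X : Polynomial ℤ) ^ a.sum ∣
        (RLProd m a i j * RLProd m a i' j' - RLProd m a i j' * RLProd m a i' j)) ∧
    (∀ i i' : Fin (m + 1), i < i' →
      (X : Polynomial ℤ) ^ (a.sum + m - 1) ∣
        (RLProd m a i 0 * RLProd m a i' (Fin.last m) -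
          RLProd m a i (Fin.last m) * RLProd m a i' 0)) := by
  have h := minorsDvd_RLProd m a
  refine ⟨fun i i' j j' _ _ => h.1 i i' j j', fun i i' _ => h.2 ?_ i i'⟩
  obtain ⟨x, hx⟩ := List.exists_mem_of_ne_nil a ha
  exact (hpos x hx).trans_le (List.single_le_sum (fun _ _ => Nat.zero_le _) x hx)
end
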